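/- Let X be a path in ℝ^d and let x ∈ T(ℝ^d) be a linear combination of words of length at most k. Then there exists a polynomial P ∈ ℝ[n] of degree at most k such that ⟨σ(X^{⊔n}), x⟩ = P(n) for every integer n ≥ 1; moreover P(0) equals the coefficient of the empty word in x, and P(−1) = ⟨σ(⟵X), x⟩. Consequently: if ⟨σ(X^{⊔n}), x⟩ = 0 for infinitely many positive integers n, then ⟨σ(⟵X), x⟩ = 0. -/

import Mathlib

open scoped BigOperators TensorProduct

namespace PathVarieties

/-- Words over an alphabet `α`; the letters `{1,…,d}` of `ℝ^d` correspond to `α = Fin d`. -/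
abbrev Word (α : Type*) := List α

/-- The tensor algebra `T(ℝ^d)`, identified with the free real vector space on words. -/
abbrev TA (α : Type*) := Word α →₀ ℝ

/-- The list of all (riffle) shuffles of two words. -/
def shuffles {α : Type*} : Word α → Word α → List (Word α)
  | [], v => [v]
  | a :: u, [] => [a :: u]
  | a :: u, b :: v =>
      ((shuffles u (b :: v)).map (a :: ·)) ++ ((shuffles (a :: u) v).map (b :: ·))
termination_by u v => u.length + v.length
decreasing_by all_goals (simp only [List.length_cons]; omega)

/-- Shuffle product of two words, as an element of `T(ℝ^d)`. -/
noncomputable def shw {α : Type*} (u v : Word α) : TA α :=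
  ((shuffles u v).map fun w => Finsupp.single w (1 : ℝ)).sum

/-- The shuffle product `⧢` on `T(ℝ^d)`, the bilinear extension of the shuffle of words. -/
noncomputable def sh {α : Type*} (x y : TA α) : TA α :=
  x.sum fun u cu => y.sum fun v cv => (cu * cv) • shw u v

/-- Right halfshuffle `u ≻ v` of words (`v` nonempty): shuffle `u` with `v` minus its
last letter, then append the last letter of `v`.  (This is the unique bilinear operation
with `w ≻ a = wa` and `w ≻ (va) = (w≻v + v≻w)a`.) -/
noncomputable def rshw {α : Type*} (u v : Word α) : TA α :=
  ((shuffles u v.dropLast).map fun w =>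
    Finsupp.single (w ++ v.drop (v.length - 1)) (1 : ℝ)).sum

/-- Right halfshuffle `≻` on `T^{≥1}(ℝ^d)`, extended bilinearly. -/
noncomputable def rsh {α : Type*} (x y : TA α) : TA α :=
  x.sum fun u cu => y.sum fun v cv => (cu * cv) • rshw u v

/-- Left halfshuffle `u ≺ v` of words (`u` nonempty): the first letter of `u` followed by
the shuffle of the rest of `u` with `v`.  (This is the unique bilinear operation with
`a ≺ w = aw` and `(av) ≺ w = a(w≺v + v≺w)`.) -/
noncomputable def lshw {α : Type*} (u v : Word α) : TA α :=
  ((shuffles u.tail v).map fun w => Finsupp.single (u.take 1 ++ w) (1 : ℝ)).sum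

/-- Left halfshuffle `≺` on `T^{≥1}(ℝ^d)`, extended bilinearly. -/
noncomputable def lsh {α : Type*} (x y : TA α) : TA α :=
  x.sum fun u cu => y.sum fun v cv => (cu * cv) • lshw u v

/-- The antipode `𝒜`, with `𝒜(i₁⋯iₙ) = (−1)ⁿ iₙ⋯i₁`. -/
noncomputable def antipode {α : Type*} (x : TA α) : TA α :=
  x.sum fun w c => Finsupp.single w.reverse (((-1 : ℝ) ^ w.length) * c)

/-- Helper for `Λ_B`: value on a reversed word. -/
noncomputable def lamRev {α β : Type*} (B : α → TA β) : Word α → TA β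
  | [] => Finsupp.single [] 1
  | [i] => B i
  | i :: w => rsh (lamRev B w) (B i)

/-- `Λ_B` on a word: `Λ_B e = e`, `Λ_B i = B i`, `Λ_B (w·i) = (Λ_B w) ≻ (Λ_B i)`. -/
noncomputable def lamW {α β : Type*} (B : α → TA β) (w : Word α) : TA β :=
  lamRev B w.reverse

/-- The linear map `Λ_B : T(ℝ^t) → T(ℝ^d)` induced by `B` on letters. -/
noncomputable def Lam {α β : Type*} (B : α → TA β) (x : TA α) : TA β :=
  x.sum fun w c => c • lamW B w

/-- `splitEmb e j n w = Σ_{w = u₁⋯uₙ} e_j(u₁) ⧢ e_{j+1}(u₂) ⧢ ⋯ ⧢ e_{j+n−1}(uₙ)`,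
the sum over all splittings of `w` into `n` consecutive (possibly empty) factors,
each factor relabelled letterwise by `e`. -/
noncomputable def splitEmb {α β : Type*} (e : ℕ → α → β) : ℕ → ℕ → Word α → TA β
  | _, 0, w => if w.isEmpty then Finsupp.single ([] : Word β) (1 : ℝ) else 0
  | j, k + 1, w => ∑ m ∈ Finset.range (w.length + 1),
      sh (Finsupp.single ((w.take m).map (e j)) (1 : ℝ)) (splitEmb e (j + 1) k (w.drop m))

/-- `Σ_{x=uv} f(u)·v`: deconcatenate, evaluate the functional `f` on prefixes. -/
noncomputable def leftAct {α : Type*} (f : Word α → ℝ) (x : TA α) : TA α :=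
  x.sum fun w c => c • ∑ k ∈ Finset.range (w.length + 1),
    f (w.take k) • Finsupp.single (w.drop k) (1 : ℝ)

/-- `Σ_{x=uv} u·f(v)`: deconcatenate, evaluate the functional `f` on suffixes. -/
noncomputable def rightAct {α : Type*} (f : Word α → ℝ) (x : TA α) : TA α :=
  x.sum fun w c => c • ∑ k ∈ Finset.range (w.length + 1),
    f (w.drop k) • Finsupp.single (w.take k) (1 : ℝ)

/-- A raw path: a time horizon `T` together with a map `ℝ → ℝ^α`
(only the restriction to `[0,T]` is relevant). -/
structure RawPath (α : Type*) where
  T : ℝ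
  toFun : ℝ → α → ℝ

/-- A path: positive time horizon, continuous on `[0,T]` and piecewise continuously
differentiable there (witnessed by a partition `0 = τ₀ < τ₁ < ⋯ < τₙ = T`). -/
def IsPath {α : Type*} (X : RawPath α) : Prop :=
  0 < X.T ∧ (∀ i, ContinuousOn (fun t => X.toFun t i) (Set.Icc 0 X.T)) ∧
    ∃ (n : ℕ) (τ : Fin (n + 1) → ℝ), StrictMono τ ∧ τ 0 = 0 ∧ τ (Fin.last n) = X.T ∧
      ∀ (k : Fin n) (i : α), ContDiffOn ℝ 1 (fun t => X.toFun t i)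
        (Set.Icc (τ k.castSucc) (τ k.succ))

/-- Iterated integrals, by recursion on the reversed word:
`sigRev X (i :: w) t = ∫₀ᵗ ⟨σ(X)ₛ, w.reverse⟩ dX⁽ⁱ⁾(s)`. -/
noncomputable def sigRev {α : Type*} (X : ℝ → α → ℝ) : Word α → ℝ → ℝ
  | [], _ => 1
  | i :: w, t => ∫ s in (0 : ℝ)..t, sigRev X w s * deriv (fun u => X u i) s

/-- `⟨σ(X)_t, w⟩`, the iterated-integrals signature of `X` stopped at time `t`. -/
noncomputable def sigUpTo {α : Type*} (X : RawPath α) (t : ℝ) (w : Word α) : ℝ :=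
  sigRev X.toFun w.reverse t

/-- `⟨σ(X), w⟩`, the iterated-integrals signature of the path `X` at a word `w`. -/
noncomputable def sig {α : Type*} (X : RawPath α) (w : Word α) : ℝ :=
  sigUpTo X X.T w

/-- Pairing of a word-indexed functional with an element of `T(ℝ^d)`. -/
noncomputable def pairF {α : Type*} (f : Word α → ℝ) (x : TA α) : ℝ :=
  x.sum fun w c => c * f w

/-- `⟨σ(X), x⟩` for a tensor `x ∈ T(ℝ^d)` (linear in `x`). -/
noncomputable def pair {α : Type*} (X : RawPath α) (x : TA α) : ℝ :=
  Finsupp.linearCombination ℝ (sig X) x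

/-- The path variety `𝒱(W)` of all paths whose signature kills every element of `W`. -/
def V {α : Type*} (W : Set (TA α)) : Set (RawPath α) :=
  {X | IsPath X ∧ ∀ x ∈ W, pair X x = 0}

/-- `ℐ(M)`, the space of tensors killed by the signature of every path in `M`. -/
noncomputable def Idl {α : Type*} (M : Set (RawPath α)) : Submodule ℝ (TA α) :=
  ⨅ X ∈ M, LinearMap.ker (Finsupp.linearCombination ℝ (sig X))

/-- Concatenation `X ⊔ Y` of paths. -/
noncomputable def concat {α : Type*} (X Y : RawPath α) : RawPath α where
  T := X.T + Y.T
  toFun := fun t i =>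
    if t ≤ X.T then X.toFun t i else Y.toFun (t - X.T) i + X.toFun X.T i - Y.toFun 0 i

/-- Time reversal `⟵X`. -/
def timeRev {α : Type*} (X : RawPath α) : RawPath α :=
  ⟨X.T, fun t i => X.toFun (X.T - t) i⟩

/-- `concatIter X n = X^{⊔(n+1)}`. -/
noncomputable def concatIter {α : Type*} (X : RawPath α) : ℕ → RawPath α
  | 0 => X
  | n + 1 => concat (concatIter X n) X

/-- `X^{⊔n}`, the `n`-fold concatenation of `X` with itself (intended for `n ≥ 1`). -/
noncomputable def concatPow {α : Type*} (X : RawPath α) (n : ℕ) : RawPath α :=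
  concatIter X (n - 1)

/-- `concatFold f k = f 0 ⊔ f 1 ⊔ ⋯ ⊔ f k`. -/
noncomputable def concatFold {α : Type*} (f : ℕ → RawPath α) : ℕ → RawPath α
  | 0 => f 0
  | k + 1 => concat (concatFold f k) (f (k + 1))

/-- The deconcatenation coproduct `Δ : T(ℝ^d) → T(ℝ^d) ⊗ T(ℝ^d)`,
`Δw = Σ_{w=uv} u ⊗ v`. -/
noncomputable def deconc {α : Type*} (x : TA α) : TensorProduct ℝ (TA α) (TA α) :=
  x.sum fun w c => c • ∑ k ∈ Finset.range (w.length + 1),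
    (Finsupp.single (w.take k) (1 : ℝ)) ⊗ₜ[ℝ] (Finsupp.single (w.drop k) (1 : ℝ))


section Convolution

variable {α : Type*}

/-- The convolution of two functionals on words, dual to deconcatenation. -/
def conv (g : Word α → ℝ) : (Word α → ℝ) → Word α → ℝ
  | f, [] => f [] * g []
  | f, i :: w => f [] * g (i :: w) + conv g (fun u => f (i :: u)) w

/-- The functional reading off the coefficient of the empty word. -/
def counit : Word α → ℝ
  | [] => 1
  | _ :: _ => 0

theorem conv_congr_right {g h : Word α → ℝ} (f : Word α → ℝ) (w : Word α)
    (H : ∀ v : Word α, v.length ≤ w.length → g v = h v) : conv g f w = conv h f w := by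
  induction w generalizing f with
  | nil => simp [conv, H]
  | cons i w ih =>
    have hw := ih (fun u => f (i :: u)) fun v hv => H v (hv.trans (by simp))
    simp [conv, H, hw]

theorem conv_counit_right (f : Word α → ℝ) (w : Word α) : conv counit f w = f w := by
  induction w generalizing f with
  | nil => simp [conv, counit]
  | cons i w ih => simp [conv, counit, ih]

theorem conv_sub_counit (f g : Word α → ℝ) (w : Word α) :
    conv g (fun u => f u - counit u) w = conv g f w - g w := by
  cases w with
  | nil => simp [conv, counit]; ring
  | cons i w => simp [conv, counit]; ring

theorem conv_mul_right (f g : Word α → ℝ) (c : ℝ) (w : Word α) :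
    conv (fun u => g u * c) f w = conv g f w * c := by
  induction w generalizing f with
  | nil => simp [conv]; ring
  | cons i w ih => simp [conv, ih]; ring

theorem conv_sum_right {ι : Type*} (s : Finset ι) (f : Word α → ℝ) (g : ι → Word α → ℝ)
    (w : Word α) : conv (fun u => ∑ j ∈ s, g j u) f w = ∑ j ∈ s, conv (g j) f w := by
  induction w generalizing f with
  | nil => simp [conv, Finset.mul_sum]
  | cons i w ih => simp [conv, ih, Finset.mul_sum, Finset.sum_add_distrib]

/-- Convolution on the left by a functional which is `1` on the empty word is injective. -/
theorem eq_of_conv_eq {f g h : Word α → ℝ} (hf : f [] = 1) (N : ℕ)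
    (H : ∀ w : Word α, w.length ≤ N → conv g f w = conv h f w) :
    ∀ w : Word α, w.length ≤ N → g w = h w := by
  suffices ∀ m, ∀ w : Word α, w.length ≤ m → w.length ≤ N → g w = h w from
    fun w hw => this _ w le_rfl hw
  intro m
  induction m with
  | zero =>
    intro w hw hN
    obtain rfl : w = [] := by simpa using hw
    simpa [conv, hf] using H [] hN
  | succ m ih =>
    intro w hw hN
    cases w with
    | nil => simpa [conv, hf] using H [] hN
    | cons i w =>
      have h1 := H (i :: w) hN
      simp only [List.length_cons] at hw hN
      have h2 := conv_congr_right (fun u => f (i :: u)) w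
        fun v hv => ih v (by omega) (by omega)
      simpa [conv, hf, h2] using h1

/-- Convolution powers of `f - counit`. -/
def subCounitPow (f : Word α → ℝ) : ℕ → Word α → ℝ
  | 0 => counit
  | j + 1 => conv (subCounitPow f j) fun u => f u - counit u

theorem conv_eq_zero {f g : Word α → ℝ} {m : ℕ} (hf : f [] = 0)
    (hg : ∀ v : Word α, v.length < m → g v = 0) (w : Word α) (hw : w.length < m + 1) :
    conv g f w = 0 := by
  cases w with
  | nil => simp [conv, hf]
  | cons i w =>
    simp only [List.length_cons] at hw
    have : conv g (fun u => f (i :: u)) w = conv (fun v => g v * 0) (fun u => f (i :: u)) w :=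
      conv_congr_right _ w fun v hv => by rw [hg v (by omega)]; simp
    rw [conv_mul_right] at this
    rw [conv, hf, zero_mul, zero_add, this, mul_zero]

theorem subCounitPow_eq_zero {f : Word α → ℝ} (hf : f [] = 1) (j : ℕ) (w : Word α)
    (hw : w.length < j) : subCounitPow f j w = 0 := by
  induction j generalizing w with
  | zero => simp at hw
  | succ j ih => exact conv_eq_zero (by simp [hf, counit]) ih w hw

end Convolution

section Newton

open Polynomial

/-- The binomial coefficient `X choose j` as a polynomial in `X`. -/
noncomputable def binomPoly : ℕ → ℝ[X]
  | 0 => 1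
  | j + 1 => C ((j + 1 : ℝ)⁻¹) * (X - C (j : ℝ)) * binomPoly j

theorem natDegree_binomPoly_le (j : ℕ) : (binomPoly j).natDegree ≤ j := by
  induction j with
  | zero => simp [binomPoly]
  | succ j ih =>
    refine natDegree_mul_le.trans ?_
    have h1 := natDegree_C_mul_le ((j + 1 : ℝ)⁻¹) (X - C (j : ℝ))
    rw [natDegree_X_sub_C] at h1
    omega

theorem eval_zero_binomPoly_succ (j : ℕ) : (binomPoly (j + 1)).eval 0 = 0 := by
  induction j with
  | zero => simp [binomPoly]
  | succ j ih => rw [binomPoly, eval_mul, ih, mul_zero]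

theorem eval_add_one_binomPoly_succ (j : ℕ) (x : ℝ) :
    (binomPoly (j + 1)).eval (x + 1) = (binomPoly (j + 1)).eval x + (binomPoly j).eval x := by
  induction j with
  | zero => simp [binomPoly]
  | succ j ih =>
    have h1 : ((j : ℝ) + 1) ≠ 0 := by positivity
    have h2 : ((j : ℝ) + 1 + 1) ≠ 0 := by positivity
    rw [binomPoly, eval_mul, ih, eval_mul]
    simp only [binomPoly, eval_mul, eval_C, eval_sub, eval_X]
    push_cast
    field_simp
    ring

variable {α : Type*}

/-- The binomial expansion of the `X`-th convolution power of `f`, evaluated at `w` and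
truncated after the term of order `N`. -/
noncomputable def powPoly (f : Word α → ℝ) (N : ℕ) (w : Word α) : ℝ[X] :=
  ∑ j ∈ Finset.range (N + 1), C (subCounitPow f j w) * binomPoly j

theorem natDegree_powPoly_le (f : Word α → ℝ) (N : ℕ) (w : Word α) :
    (powPoly f N w).natDegree ≤ N := by
  refine natDegree_sum_le_of_forall_le _ _ fun j hj => ?_
  have hj' := Finset.mem_range.1 hj
  exact (natDegree_C_mul_le _ _).trans ((natDegree_binomPoly_le j).trans (by omega))

theorem eval_powPoly (f : Word α → ℝ) (N : ℕ) (w : Word α) (x : ℝ) :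
    (powPoly f N w).eval x =
      ∑ j ∈ Finset.range (N + 1), subCounitPow f j w * (binomPoly j).eval x := by
  simp [powPoly, eval_finsetSum]

theorem eval_zero_powPoly (f : Word α → ℝ) (N : ℕ) (w : Word α) :
    (powPoly f N w).eval 0 = counit w := by
  rw [eval_powPoly, Finset.sum_range_succ', Finset.sum_eq_zero]
  · simp [binomPoly, subCounitPow]
  · intro j _
    rw [eval_zero_binomPoly_succ, mul_zero]

theorem eval_add_one_powPoly {f : Word α → ℝ} (hf : f [] = 1) (N : ℕ) (w : Word α)
    (hw : w.length ≤ N) (x : ℝ) :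
    (powPoly f N w).eval (x + 1) = conv (fun v => (powPoly f N v).eval x) f w := by
  have h1 := conv_sub_counit f (fun v => (powPoly f N v).eval x) w
  have h2 : conv (fun v => (powPoly f N v).eval x) (fun u => f u - counit u) w =
      ∑ j ∈ Finset.range N, subCounitPow f (j + 1) w * (binomPoly j).eval x := by
    simp only [eval_powPoly]
    rw [conv_sum_right, Finset.sum_range_succ]
    simp only [conv_mul_right]
    have h3 := subCounitPow_eq_zero hf (N + 1) w (by omega)
    simp only [subCounitPow] at h3 ⊢
    rw [h3, zero_mul, add_zero]
  have h4 : (powPoly f N w).eval (x + 1) = (powPoly f N w).eval x +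
      ∑ j ∈ Finset.range N, subCounitPow f (j + 1) w * (binomPoly j).eval x := by
    rw [eval_powPoly, eval_powPoly, Finset.sum_range_succ', Finset.sum_range_succ']
    simp only [eval_add_one_binomPoly_succ, mul_add, Finset.sum_add_distrib]
    simp [binomPoly]
    ring
  linarith

end Newton

section IteratedIntegral

open MeasureTheory intervalIntegral Set

variable {α : Type*}

/-- Iterated integrals of the velocities `f` with base point `a`, the letters of the word being
listed from the latest to the earliest time. -/
noncomputable def itInt (f : α → ℝ → ℝ) (a : ℝ) : Word α → ℝ → ℝ
  | [], _ => 1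
  | i :: w, t => ∫ s in a..t, itInt f a w s * f i s

theorem itInt_self (f : α → ℝ → ℝ) (a : ℝ) (w : Word α) : itInt f a w a = counit w := by
  cases w <;> simp [itInt, counit]

theorem continuous_itInt {f : α → ℝ → ℝ} (hf : ∀ i, Integrable (f i)) (a : ℝ) (w : Word α) :
    Continuous (itInt f a w) := by
  induction w with
  | nil => exact continuous_const
  | cons i w ih =>
    exact continuous_primitive
      (fun b c => ((hf i).intervalIntegrable).continuousOn_mul ih.continuousOn) a

theorem intervalIntegrable_itInt_mul {f : α → ℝ → ℝ} (hf : ∀ i, Integrable (f i)) (a b c : ℝ)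
    (w : Word α) (i : α) : IntervalIntegrable (fun s => itInt f a w s * f i s) volume b c :=
  ((hf i).intervalIntegrable).continuousOn_mul (continuous_itInt hf a w).continuousOn

theorem integral_conv_mul {F : Word α → ℝ → ℝ} {φ : ℝ → ℝ} {b c : ℝ}
    (hF : ∀ u, IntervalIntegrable (fun s => F u s * φ s) volume b c) (g : Word α → ℝ)
    (w : Word α) :
    IntervalIntegrable (fun s => conv g (fun u => F u s) w * φ s) volume b c ∧
      ∫ s in b..c, conv g (fun u => F u s) w * φ s =
        conv g (fun u => ∫ s in b..c, F u s * φ s) w := by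
  induction w generalizing F with
  | nil =>
    simp only [conv, mul_right_comm _ (g []) (φ _)]
    exact ⟨(hF []).mul_const _, intervalIntegral.integral_mul_const _ _⟩
  | cons i w ih =>
    obtain ⟨h1, h2⟩ := ih (F := fun u => F (i :: u)) fun u => hF _
    simp only [conv, add_mul, mul_right_comm _ (g (i :: w)) (φ _)]
    have h3 := (hF []).mul_const (g (i :: w))
    refine ⟨h3.add h1, ?_⟩
    rw [integral_add h3 h1, h2, intervalIntegral.integral_mul_const]

/-- Chen's identity. -/
theorem itInt_eq_conv {f : α → ℝ → ℝ} (hf : ∀ i, Integrable (f i)) (a b c : ℝ) (w : Word α) :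
    itInt f a w c = conv (fun v => itInt f a v b) (fun u => itInt f b u c) w := by
  induction w generalizing c with
  | nil => simp [conv, itInt]
  | cons i w ih =>
    have h1 := intervalIntegrable_itInt_mul hf a a b w i
    have h2 := intervalIntegrable_itInt_mul hf a b c w i
    have h3 := (integral_conv_mul (F := fun u s => itInt f b u s) (φ := f i)
      (fun u => intervalIntegrable_itInt_mul hf b b c u i) (fun v => itInt f a v b) w).2
    simp only [← ih] at h3
    simp only [conv, itInt, one_mul]
    rw [← integral_add_adjacent_intervals h1 h2, h3]

theorem itInt_congr {f g : α → ℝ → ℝ} {a b : ℝ}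
    (H : ∀ i, ∀ᵐ s, s ∈ Ioc a b → f i s = g i s) (w : Word α) {t : ℝ} (hat : a ≤ t)
    (htb : t ≤ b) : itInt f a w t = itInt g a w t := by
  induction w generalizing t with
  | nil => rfl
  | cons i w ih =>
    refine integral_congr_ae ?_
    filter_upwards [H i] with s hs hst
    rw [uIoc_of_le hat] at hst
    rw [hs ⟨hst.1, hst.2.trans htb⟩, ih hst.1.le (hst.2.trans htb)]

theorem itInt_comp_sub_right (f : α → ℝ → ℝ) (a c : ℝ) (w : Word α) (t : ℝ) :
    itInt (fun i s => f i (s - c)) (a + c) w t = itInt f a w (t - c) := by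
  induction w generalizing t with
  | nil => rfl
  | cons i w ih =>
    simp only [itInt, ih]
    rw [integral_comp_sub_right (fun s => itInt f a w s * f i s) c, add_sub_cancel_right]

theorem itInt_comp_sub_left (f : α → ℝ → ℝ) (a : ℝ) (w : Word α) (t : ℝ) :
    itInt (fun i s => -f i (a - s)) 0 w t = itInt f a w (a - t) := by
  induction w generalizing t with
  | nil => rfl
  | cons i w ih =>
    simp only [itInt, ih, mul_neg, intervalIntegral.integral_neg]
    rw [integral_comp_sub_left (fun s => itInt f a w s * f i s) a, sub_zero, integral_symm,
      neg_neg]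

end IteratedIntegral

section Signature

open MeasureTheory Set

variable {α : Type*}

/-- The velocity of a path, extended by zero outside its time interval. -/
noncomputable def velocity (X : RawPath α) (i : α) : ℝ → ℝ :=
  (Ioo 0 X.T).indicator (deriv fun u => X.toFun u i)

theorem sigRev_eq_itInt_deriv (X : ℝ → α → ℝ) (w : Word α) (t : ℝ) :
    sigRev X w t = itInt (fun i => deriv fun u => X u i) 0 w t := by
  induction w generalizing t with
  | nil => rfl
  | cons i w ih => simp only [sigRev, itInt, ih]

theorem ae_ne_real (a : ℝ) : ∀ᵐ s : ℝ, s ≠ a := by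
  simp [ae_iff]

theorem sigRev_eq_itInt {X : RawPath α} (hX : 0 ≤ X.T) (w : Word α) :
    sigRev X.toFun w X.T = itInt (velocity X) 0 w X.T := by
  rw [sigRev_eq_itInt_deriv]
  refine itInt_congr (fun i => ?_) w hX le_rfl
  filter_upwards [ae_ne_real X.T] with s hs hst
  rw [velocity, indicator_of_mem]
  exact ⟨hst.1, lt_of_le_of_ne hst.2 hs⟩

theorem IsPath.integrable_velocity {X : RawPath α} (hX : IsPath X) (i : α) :
    Integrable (velocity X i) := by
  obtain ⟨hT, -, n, τ, hτ, h0, hn, hC⟩ := hX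
  rw [velocity, integrable_indicator_iff measurableSet_Ioo, ← integrableOn_Ioc_iff_integrableOn_Ioo,
    ← intervalIntegrable_iff_integrableOn_Ioc_of_le hT.le]
  set a : ℕ → ℝ := fun k => τ (Fin.ofNat (n + 1) k) with ha
  have ha0 : a 0 = 0 := by simp [ha, h0]
  have han : a n = X.T := by
    simp only [ha, ← hn]
    congr 1
    ext
    simp
  rw [← ha0, ← han]
  refine IntervalIntegrable.trans_iterate fun k hk => ?_
  have h1 : a k = τ (Fin.castSucc ⟨k, hk⟩) := by
    simp only [ha]
    congr 1
    ext
    simp [Nat.mod_eq_of_lt (show k < n + 1 by omega)]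
  have h2 : a (k + 1) = τ (Fin.succ ⟨k, hk⟩) := by
    simp only [ha]
    congr 1
    ext
    simp [Nat.mod_eq_of_lt (show k + 1 < n + 1 by omega)]
  rw [h1, h2]
  have hlt : τ (Fin.castSucc ⟨k, hk⟩) < τ (Fin.succ ⟨k, hk⟩) := hτ Fin.castSucc_lt_succ
  have h3 := (hC ⟨k, hk⟩ i).continuousOn_derivWithin (uniqueDiffOn_Icc hlt) le_rfl
  have h4 := (h3.intervalIntegrable_of_Icc (μ := volume) hlt.le)
  rw [intervalIntegrable_iff_integrableOn_Ioo_of_le hlt.le] at h4 ⊢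
  refine h4.congr_fun (fun s hs => ?_) measurableSet_Ioo
  exact derivWithin_of_mem_nhds (Icc_mem_nhds hs.1 hs.2)

theorem velocity_concat_of_lt {X Y : RawPath α} (hY : 0 ≤ Y.T) (i : α) {s : ℝ} (hs : s < X.T) :
    velocity (concat X Y) i s = velocity X i s := by
  have h : (fun u => (concat X Y).toFun u i) =ᶠ[nhds s] fun u => X.toFun u i := by
    filter_upwards [Iio_mem_nhds hs] with u hu
    exact if_pos (le_of_lt hu)
  have hT : s < (concat X Y).T := by simp only [concat]; linarith
  by_cases h0 : 0 < s
  · rw [velocity, velocity, indicator_of_mem (mem_Ioo.2 ⟨h0, hT⟩),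
      indicator_of_mem (mem_Ioo.2 ⟨h0, hs⟩), h.deriv_eq]
  · rw [velocity, velocity, indicator_of_notMem (fun h => h0 h.1),
      indicator_of_notMem (fun h => h0 h.1)]

theorem velocity_concat_of_gt {X Y : RawPath α} (hX : 0 ≤ X.T) (i : α) {s : ℝ} (hs : X.T < s) :
    velocity (concat X Y) i s = velocity Y i (s - X.T) := by
  have h : (fun u => (concat X Y).toFun u i) =ᶠ[nhds s]
      fun u => Y.toFun (u - X.T) i + (X.toFun X.T i - Y.toFun 0 i) := by
    filter_upwards [Ioi_mem_nhds hs] with u hu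
    simp only [concat]
    rw [if_neg (not_le.2 hu), add_sub_assoc]
  have hd : deriv (fun u => (concat X Y).toFun u i) s =
      deriv (fun u => Y.toFun u i) (s - X.T) := by
    rw [h.deriv_eq, deriv_add_const, deriv_comp_sub_const (fun u => Y.toFun u i)]
  have hmem : s ∈ Ioo 0 (concat X Y).T ↔ s - X.T ∈ Ioo 0 Y.T := by
    simp only [concat, mem_Ioo]
    constructor <;> rintro ⟨h1, h2⟩ <;> constructor <;> linarith
  by_cases hm : s ∈ Ioo 0 (concat X Y).T
  · rw [velocity, velocity, indicator_of_mem hm, indicator_of_mem (hmem.1 hm), hd]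
  · rw [velocity, velocity, indicator_of_notMem hm, indicator_of_notMem (hmem.not.1 hm)]

theorem integrable_velocity_concat {X Y : RawPath α} (hX : 0 ≤ X.T) (hY : 0 ≤ Y.T) (i : α)
    (hXi : Integrable (velocity X i)) (hYi : Integrable (velocity Y i)) :
    Integrable (velocity (concat X Y) i) := by
  refine (hXi.add (hYi.comp_sub_right X.T)).congr ?_
  filter_upwards [ae_ne_real X.T] with s hs
  rcases lt_or_gt_of_ne hs with h | h
  · rw [velocity_concat_of_lt hY i h, Pi.add_apply, velocity, velocity,
      indicator_of_notMem (s := Ioo 0 Y.T) (fun h' => by linarith [h'.1]), add_zero]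
  · rw [velocity_concat_of_gt hX i h, Pi.add_apply, velocity, velocity,
      indicator_of_notMem (s := Ioo 0 X.T) (fun h' => by linarith [h'.2]), zero_add]

/-- The signature of a concatenation is the convolution of the signatures. -/
theorem sigRev_concat {X Y : RawPath α} (hX : 0 ≤ X.T) (hY : 0 ≤ Y.T)
    (hXi : ∀ i, Integrable (velocity X i)) (hYi : ∀ i, Integrable (velocity Y i))
    (w : Word α) :
    sigRev (concat X Y).toFun w (concat X Y).T =
      conv (fun v => sigRev X.toFun v X.T) (fun u => sigRev Y.toFun u Y.T) w := by
  have hT : (concat X Y).T = X.T + Y.T := rfl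
  rw [sigRev_eq_itInt (by rw [hT]; positivity), itInt_eq_conv
    (fun i => integrable_velocity_concat hX hY i (hXi i) (hYi i)) 0 X.T]
  congr 1
  · funext v
    rw [sigRev_eq_itInt hX]
    refine itInt_congr (fun i => ?_) v hX le_rfl
    filter_upwards [ae_ne_real X.T] with s hs hst
    exact velocity_concat_of_lt hY i (lt_of_le_of_ne hst.2 hs)
  · funext u
    have h := itInt_comp_sub_right (velocity Y) 0 X.T u (X.T + Y.T)
    rw [zero_add, add_sub_cancel_left] at h
    rw [sigRev_eq_itInt hY, ← h, hT]
    refine itInt_congr (fun i => ?_) u (by linarith) le_rfl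
    exact Filter.Eventually.of_forall fun s hs => velocity_concat_of_gt hX i hs.1

theorem velocity_timeRev (X : RawPath α) (i : α) (s : ℝ) :
    velocity (timeRev X) i s = -velocity X i (X.T - s) := by
  have hd : deriv (fun u => (timeRev X).toFun u i) s =
      -deriv (fun u => X.toFun u i) (X.T - s) :=
    deriv_comp_const_sub (fun u => X.toFun u i) X.T s
  have hmem : s ∈ Ioo 0 (timeRev X).T ↔ X.T - s ∈ Ioo 0 X.T := by
    simp only [timeRev, mem_Ioo]
    constructor <;> rintro ⟨h1, h2⟩ <;> constructor <;> linarith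
  by_cases hm : s ∈ Ioo 0 (timeRev X).T
  · rw [velocity, velocity, indicator_of_mem hm, indicator_of_mem (hmem.1 hm), hd]
  · rw [velocity, velocity, indicator_of_notMem hm, indicator_of_notMem (hmem.not.1 hm), neg_zero]

/-- The signature of the time reversal is the convolution inverse of the signature. -/
theorem conv_sigRev_timeRev {X : RawPath α} (hX : 0 ≤ X.T)
    (hXi : ∀ i, Integrable (velocity X i)) (w : Word α) :
    conv (fun v => sigRev (timeRev X).toFun v (timeRev X).T) (fun u => sigRev X.toFun u X.T) w =
      counit w := by
  have h := itInt_eq_conv hXi X.T 0 X.T w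
  rw [itInt_self] at h
  rw [h]
  congr 1
  · funext v
    rw [sigRev_eq_itInt (X := timeRev X) hX,
      show velocity (timeRev X) = fun i s => -velocity X i (X.T - s) from
        funext fun i => funext fun s => velocity_timeRev X i s, itInt_comp_sub_left]
    simp [timeRev]
  · funext u
    exact sigRev_eq_itInt hX u

theorem concatIter_regular {X : RawPath α} (hX : 0 ≤ X.T)
    (hXi : ∀ i, Integrable (velocity X i)) (n : ℕ) :
    0 ≤ (concatIter X n).T ∧ ∀ i, Integrable (velocity (concatIter X n) i) := by
  induction n with
  | zero => exact ⟨hX, hXi⟩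
  | succ n ih =>
    exact ⟨add_nonneg ih.1 hX, fun i => integrable_velocity_concat ih.1 hX i (ih.2 i) (hXi i)⟩

theorem eval_powPoly_sigRev_concatIter {X : RawPath α} (hX : 0 ≤ X.T)
    (hXi : ∀ i, Integrable (velocity X i)) (N n : ℕ) (w : Word α) (hw : w.length ≤ N) :
    (powPoly (fun u => sigRev X.toFun u X.T) N w).eval ((n : ℝ) + 1) =
      sigRev (concatIter X n).toFun w (concatIter X n).T := by
  induction n generalizing w with
  | zero =>
    rw [Nat.cast_zero, eval_add_one_powPoly (by simp [sigRev]) N w hw]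
    simp only [eval_zero_powPoly]
    exact conv_counit_right _ w
  | succ n ih =>
    have h := concatIter_regular hX hXi n
    rw [eval_add_one_powPoly (by simp [sigRev]) N w hw, concatIter, sigRev_concat h.1 hX h.2 hXi]
    refine conv_congr_right _ w fun v hv => ?_
    rw [Nat.cast_succ, ih v (hv.trans hw)]

theorem eval_neg_one_powPoly_sigRev {X : RawPath α} (hX : 0 ≤ X.T)
    (hXi : ∀ i, Integrable (velocity X i)) (N : ℕ) (w : Word α) (hw : w.length ≤ N) :
    (powPoly (fun u => sigRev X.toFun u X.T) N w).eval (-1) =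
      sigRev (timeRev X).toFun w (timeRev X).T := by
  refine eq_of_conv_eq (f := fun u => sigRev X.toFun u X.T)
    (g := fun v => (powPoly (fun u => sigRev X.toFun u X.T) N v).eval (-1))
    (h := fun v => sigRev (timeRev X).toFun v (timeRev X).T) (by simp [sigRev]) N
    (fun v hv => ?_) w hw
  rw [conv_sigRev_timeRev hX hXi, ← eval_add_one_powPoly (by simp [sigRev]) N v hv,
    neg_add_cancel, eval_zero_powPoly]

end Signature

/-- For a path `X` and a tensor `x` supported on words of length at
most `k`, there is a polynomial `P` of degree at most `k` with
`⟨σ(X^{⊔n}), x⟩ = P(n)` for all integers `n ≥ 1`, `P(0) = ⟨x, e⟩` and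
`P(−1) = ⟨σ(⟵X), x⟩`.  Consequently, if `⟨σ(X^{⊔n}), x⟩ = 0` for infinitely many
positive integers `n`, then `⟨σ(⟵X), x⟩ = 0`. -/
theorem statement18 {d k : ℕ} (X : RawPath (Fin d)) (hX : IsPath X)
    (x : TA (Fin d)) (hx : ∀ w ∈ x.support, w.length ≤ k) :
    (∃ P : Polynomial ℝ, P.natDegree ≤ k ∧
      (∀ n : ℕ, 1 ≤ n → Polynomial.eval (n : ℝ) P = pair (concatPow X n) x) ∧
      Polynomial.eval 0 P = x [] ∧
      Polynomial.eval (-1) P = pair (timeRev X) x) ∧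
    ({n : ℕ | 1 ≤ n ∧ pair (concatPow X n) x = 0}.Infinite →
      pair (timeRev X) x = 0) := by
  have hT : 0 ≤ X.T := hX.1.le
  have hXi := hX.integrable_velocity
  have hpair : ∀ Y : RawPath (Fin d),
      pair Y x = ∑ w ∈ x.support, x w * sigRev Y.toFun w.reverse Y.T := fun Y => by
    simp [pair, Finsupp.linearCombination_apply, Finsupp.sum, sig, sigUpTo]
  set g : Word (Fin d) → ℝ := fun u => sigRev X.toFun u X.T with hg
  have key : ∃ P : Polynomial ℝ, P.natDegree ≤ k ∧
      (∀ n : ℕ, 1 ≤ n → Polynomial.eval (n : ℝ) P = pair (concatPow X n) x) ∧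
      Polynomial.eval 0 P = x [] ∧
      Polynomial.eval (-1) P = pair (timeRev X) x := by
    refine ⟨∑ w ∈ x.support, Polynomial.C (x w) * powPoly g k w.reverse, ?_, ?_, ?_, ?_⟩
    · exact Polynomial.natDegree_sum_le_of_forall_le _ _ fun w _ =>
        (Polynomial.natDegree_C_mul_le _ _).trans (natDegree_powPoly_le g k _)
    · intro n hn
      obtain ⟨m, rfl⟩ := Nat.exists_eq_add_of_le' hn
      rw [hpair, Polynomial.eval_finsetSum]
      refine Finset.sum_congr rfl fun w hw => ?_
      rw [Polynomial.eval_mul, Polynomial.eval_C, Nat.cast_succ,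
        eval_powPoly_sigRev_concatIter hT hXi k m _ (by simpa using hx w hw)]
      rfl
    · simp only [Polynomial.eval_finsetSum, Polynomial.eval_mul, Polynomial.eval_C,
        eval_zero_powPoly]
      rw [Finset.sum_eq_single []]
      · simp [counit]
      · intro w _ hw
        obtain ⟨i, v, hv⟩ := List.exists_cons_of_ne_nil (List.reverse_ne_nil_iff.2 hw)
        simp [hv, counit]
      · intro h
        simp [Finsupp.notMem_support_iff.1 h]
    · rw [hpair, Polynomial.eval_finsetSum]
      refine Finset.sum_congr rfl fun w hw => ?_
      rw [Polynomial.eval_mul, Polynomial.eval_C,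
        eval_neg_one_powPoly_sigRev hT hXi k _ (by simpa using hx w hw)]
  refine ⟨key, fun hinf => ?_⟩
  obtain ⟨P, -, hP, -, hP1⟩ := key
  have hP0 : P = 0 := by
    refine Polynomial.eq_zero_of_infinite_isRoot P
      ((hinf.image (Nat.cast_injective (R := ℝ)).injOn).mono ?_)
    rintro _ ⟨n, ⟨hn, h0⟩, rfl⟩
    exact (hP n hn).trans h0
  rw [← hP1, hP0, Polynomial.eval_zero]

end PathVarieties
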